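/- Let k > 30 be a P-integer, set T = φ(k) + ω(k), let t = ⌊p_T / k⌋, and put h(k) = 1.7811·log(log k) + 2.51/log(log k). Then t + 1 > (log k − log h(k)) / h(k). -/

import Mathlib

open scoped BigOperators

/-- Number of primes not exceeding the real number `x` (so `primePi x = 0` for `x ≤ 1`). -/
noncomputable def primePi (x : ℝ) : ℕ :=
  ((Finset.range (⌊x⌋₊ + 1)).filter Nat.Prime).card

/-- The `n`-th prime, with `nthPrime 1 = 2`, `nthPrime 2 = 3`, etc. -/
noncomputable def nthPrime (n : ℕ) : ℕ := Nat.nth Nat.Prime (n - 1)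
/-- The `i`-th (0-indexed) prime not dividing `k`, in increasing order. -/
noncomputable def nthPrimeNotDvd (k i : ℕ) : ℕ := Nat.nth (fun p => p.Prime ∧ ¬ p ∣ k) i

/-- `k` is a `P`-integer: `k > 1` and the first `φ(k)` primes not dividing `k` are pairwise
incongruent modulo `k` and their residues are exactly the residues coprime to `k`. -/
def IsPInteger (k : ℕ) : Prop :=
  1 < k ∧
  Set.InjOn (fun i => nthPrimeNotDvd k i % k) (Set.Iio k.totient) ∧
  (fun i => nthPrimeNotDvd k i % k) '' Set.Iio k.totient = {r | r < k ∧ Nat.Coprime r k}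

open Finset

/-- The multiples of a prime `p` inside an arithmetic progression whose difference is prime to `p`
form a progression of difference `d * p`. -/
theorem exists_card_filter_dvd_progression (P : ℕ → Prop) [DecidablePred P] {p a d : ℕ}
    (hp : p.Prime) (hd : ¬ p ∣ d) (X : ℕ) :
    ∃ b Y : ℕ, |(Y : ℝ) - X / p| ≤ 1 ∧
      #{j ∈ range X | p ∣ a + d * j ∧ P (a + d * j)} = #{i ∈ range Y | P (b + d * p * i)} := by
  have hp0 : 0 < p := hp.pos
  have hpR : (0 : ℝ) < p := by exact_mod_cast hp0
  obtain ⟨j₀, hj₀, hdvd⟩ : ∃ j₀ < p, p ∣ a + d * j₀ := by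
    have := Fact.mk hp
    have hd' : (d : ZMod p) ≠ 0 := by rwa [Ne, ZMod.natCast_eq_zero_iff]
    refine ⟨(-(a : ZMod p) / d).val, ZMod.val_lt _, ?_⟩
    rw [← ZMod.natCast_eq_zero_iff]
    push_cast
    rw [ZMod.natCast_zmod_val]
    field_simp
    ring
  have key : ∀ j, p ∣ a + d * j ↔ ∃ i, j = j₀ + p * i := by
    intro j
    constructor
    · intro h
      have hz : (p : ℤ) ∣ (j : ℤ) - j₀ := by
        have h1 : (p : ℤ) ∣ (d : ℤ) * ((j : ℤ) - j₀) := by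
          have e : (d : ℤ) * ((j : ℤ) - j₀) = ((a + d * j : ℕ) : ℤ) - ((a + d * j₀ : ℕ) : ℤ) := by
            push_cast; ring
          rw [e]
          exact dvd_sub (by exact_mod_cast h) (by exact_mod_cast hdvd)
        rcases (Nat.prime_iff_prime_int.1 hp).dvd_or_dvd h1 with h2 | h2
        · exact absurd (by exact_mod_cast h2) hd
        · exact h2
      have hmod : j₀ % p = j % p := ((Nat.modEq_iff_dvd).2 hz : j₀ ≡ j [MOD p])
      rw [Nat.mod_eq_of_lt hj₀] at hmod
      exact ⟨j / p, by rw [hmod]; exact (Nat.mod_add_div j p).symm⟩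
    · rintro ⟨i, rfl⟩
      have e : a + d * (j₀ + p * i) = (a + d * j₀) + p * (d * i) := by ring
      rw [e]
      exact dvd_add hdvd (dvd_mul_right _ _)
  refine ⟨a + d * j₀, (X + (p - 1 - j₀)) / p, ?_, ?_⟩
  · set Y := (X + (p - 1 - j₀)) / p with hY
    have h1 : p * Y ≤ X + (p - 1 - j₀) := Nat.mul_div_le _ _
    have h2 : X + (p - 1 - j₀) < p * (Y + 1) := by
      rw [mul_comm]; exact Nat.lt_mul_of_div_lt (Nat.lt_succ_self _) hp0
    have h1' : p * Y ≤ X + p := by omega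
    have h2' : X ≤ p * (Y + 1) := by omega
    have h1R : (p : ℝ) * Y ≤ X + p := by exact_mod_cast h1'
    have h2R : (X : ℝ) ≤ p * (Y + 1) := by exact_mod_cast h2'
    have e : (X : ℝ) / p * p = X := by field_simp
    rw [abs_le]
    constructor <;> nlinarith
  · symm
    refine Finset.card_bij (fun i _ => j₀ + p * i) ?_ ?_ ?_
    · intro i hi
      simp only [mem_filter, mem_range] at hi ⊢
      have h3 := (Nat.le_div_iff_mul_le hp0).1 (Nat.succ_le_of_lt hi.1)
      have h4 : (i + 1) * p = p * i + p := by ring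
      rw [Nat.succ_eq_add_one, h4] at h3
      refine ⟨by omega, (key _).2 ⟨i, rfl⟩, ?_⟩
      have e : a + d * (j₀ + p * i) = a + d * j₀ + d * p * i := by ring
      rw [e]; exact hi.2
    · intro i _ i' _ h
      exact Nat.eq_of_mul_eq_mul_left hp0 (Nat.add_left_cancel h)
    · intro j hj
      simp only [mem_filter, mem_range] at hj
      obtain ⟨hjX, hjp, hjP⟩ := hj
      obtain ⟨i, rfl⟩ := (key j).1 hjp
      refine ⟨i, ?_, rfl⟩
      simp only [mem_filter, mem_range]
      constructor
      · refine Nat.lt_of_succ_le ((Nat.le_div_iff_mul_le hp0).2 ?_)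
        have h4 : (i + 1) * p = p * i + p := by ring
        rw [Nat.succ_eq_add_one, h4]
        omega
      · have e : a + d * (j₀ + p * i) = a + d * j₀ + d * p * i := by ring
        rw [← e]; exact hjP

theorem prod_one_sub_inv_mem_Icc (s : Finset ℕ) :
    0 ≤ ∏ p ∈ s, (1 - (p : ℝ)⁻¹) ∧ ∏ p ∈ s, (1 - (p : ℝ)⁻¹) ≤ 1 := by
  have h : ∀ p : ℕ, 0 ≤ 1 - (p : ℝ)⁻¹ ∧ 1 - (p : ℝ)⁻¹ ≤ 1 := fun p =>
    ⟨sub_nonneg.2 (Nat.cast_inv_le_one p), sub_le_self _ (by positivity)⟩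
  exact ⟨Finset.prod_nonneg fun p _ => (h p).1,
    Finset.prod_le_one (fun p _ => (h p).1) fun p _ => (h p).2⟩

/-- Legendre's sieve in an arithmetic progression. -/
theorem abs_card_sieve_sub_le (s : Finset ℕ) (hs : ∀ p ∈ s, p.Prime) :
    ∀ (a d X : ℕ), (∀ p ∈ s, ¬ p ∣ d) →
      |(#{j ∈ range X | ∀ p ∈ s, ¬ p ∣ a + d * j} : ℝ) - X * ∏ p ∈ s, (1 - (p : ℝ)⁻¹)|
        ≤ 2 ^ #s - 1 := by
  induction s using Finset.induction_on with
  | empty => intro a d X _; simp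
  | insert p s hps ih =>
    intro a d X hd
    have hs' : ∀ q ∈ s, q.Prime := fun q hq => hs q (mem_insert_of_mem hq)
    have hp : p.Prime := hs p (mem_insert_self _ _)
    have hpd : ¬ p ∣ d := hd p (mem_insert_self _ _)
    have hd' : ∀ q ∈ s, ¬ q ∣ d := fun q hq => hd q (mem_insert_of_mem hq)
    obtain ⟨b, Y, hY, hcard⟩ :=
      exists_card_filter_dvd_progression (fun n => ∀ q ∈ s, ¬ q ∣ n) (a := a) hp hpd X
    have hsplit : (#{j ∈ range X | ∀ q ∈ s, ¬ q ∣ a + d * j} : ℝ) =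
        #{j ∈ range X | ∀ q ∈ insert p s, ¬ q ∣ a + d * j} +
          #{i ∈ range Y | ∀ q ∈ s, ¬ q ∣ b + d * p * i} := by
      rw [← hcard, ← Nat.cast_add, ← Finset.card_union_of_disjoint]
      · congr 2
        ext j
        simp only [mem_filter, mem_union, mem_range, Finset.forall_mem_insert]
        tauto
      · rw [Finset.disjoint_left]
        intro j h1 h2
        simp only [mem_filter, Finset.forall_mem_insert] at h1 h2
        exact h1.2.1 h2.2.1
    have h1 := ih hs' a d X hd'
    have h2 := ih hs' b (d * p) Y (by
      intro q hq hdv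
      rcases (hs' q hq).dvd_mul.1 hdv with h | h
      · exact hd' q hq h
      · exact hps (((Nat.prime_dvd_prime_iff_eq (hs' q hq) hp).1 h) ▸ hq))
    obtain ⟨hP0, hP1⟩ := prod_one_sub_inv_mem_Icc s
    rw [Finset.prod_insert hps, Finset.card_insert_of_notMem hps, pow_succ]
    set c := ∏ q ∈ s, (1 - (q : ℝ)⁻¹)
    have h3 : |((Y : ℝ) - X / p) * c| ≤ 1 := by
      rw [abs_mul, abs_of_nonneg hP0]
      nlinarith [abs_nonneg ((Y : ℝ) - X / p)]
    have e : (X : ℝ) * ((1 - (p : ℝ)⁻¹) * c) = X * c - X / p * c := by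
      rw [div_eq_mul_inv]; ring
    rw [e]
    rw [abs_le] at h1 h2 h3 ⊢
    constructor <;> linarith [h1.1, h1.2, h2.1, h2.2, h3.1, h3.2]

theorem card_add_two_le_max {s : Finset ℕ} (hs : ∀ p ∈ s, p.Prime) {m : ℕ}
    (hm : ∀ p ∈ s, p ≤ m) (h3 : 3 ≤ #s) : #s + 2 ≤ m := by
  have h2 : s ⊆ (Icc 2 m).erase 4 := by
    intro p hp
    refine mem_erase.2 ⟨?_, mem_Icc.2 ⟨(hs p hp).two_le, hm p hp⟩⟩
    rintro rfl
    exact absurd (hs 4 hp) (by norm_num)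
  have hle : #s ≤ #(Icc 2 m) := card_le_card (h2.trans (erase_subset _ _))
  rw [Nat.card_Icc] at hle
  have h4 : 4 ∈ Icc 2 m := mem_Icc.2 ⟨by norm_num, by omega⟩
  have := card_le_card h2
  rw [card_erase_of_mem h4, Nat.card_Icc] at this
  omega

theorem card_add_one_le_max {s : Finset ℕ} (hs : ∀ p ∈ s, p.Prime) {m : ℕ}
    (hm : ∀ p ∈ s, p ≤ m) (h : s.Nonempty) : #s + 1 ≤ m := by
  have h2 : s ⊆ Icc 2 m := fun p hp => mem_Icc.2 ⟨(hs p hp).two_le, hm p hp⟩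
  have := card_le_card h2
  rw [Nat.card_Icc] at this
  have := h.card_pos
  omega

theorem le_prod_one_sub_inv (n : ℕ) : ∀ s : Finset ℕ, (∀ p ∈ s, p.Prime) → #s = n →
    4 / (3 * ((n : ℝ) + 2)) ≤ ∏ p ∈ s, (1 - (p : ℝ)⁻¹) := by
  have weak : ∀ (n : ℕ) (s : Finset ℕ), (∀ p ∈ s, p.Prime) → #s = n →
      1 / ((n : ℝ) + 1) ≤ ∏ p ∈ s, (1 - (p : ℝ)⁻¹) := by
    intro n
    induction n with
    | zero =>
      intro s _ h0
      rw [card_eq_zero.1 h0]; simp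
    | succ n ih =>
      intro s hs hn
      have hne : s.Nonempty := card_pos.1 (by omega)
      have hmem := s.max'_mem hne
      have hmax := card_add_one_le_max hs (m := s.max' hne) (fun p hp => s.le_max' p hp) hne
      set m := s.max' hne
      have hih := ih (s.erase m) (fun p hp => hs p (mem_of_mem_erase hp))
        (by rw [card_erase_of_mem hmem]; omega)
      rw [← mul_prod_erase s _ hmem]
      have hm : (n : ℝ) + 2 ≤ m := by rw [hn] at hmax; exact_mod_cast hmax
      have hinv : (m : ℝ)⁻¹ ≤ ((n : ℝ) + 2)⁻¹ := inv_anti₀ (by positivity) hm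
      have e : 1 / (((n + 1 : ℕ) : ℝ) + 1) = (1 - ((n : ℝ) + 2)⁻¹) * (1 / ((n : ℝ) + 1)) := by
        push_cast; field_simp; ring
      rw [e]
      refine mul_le_mul (by linarith) hih (by positivity) ?_
      have : ((n : ℝ) + 2)⁻¹ ≤ 1 := inv_le_one_of_one_le₀ (by linarith [n.cast_nonneg (α := ℝ)])
      linarith
  induction n with
  | zero =>
    intro s _ h0
    rw [card_eq_zero.1 h0]; norm_num
  | succ n ih =>
    intro s hs hn
    by_cases h3 : n < 2
    · refine le_trans ?_ (weak (n + 1) s hs hn)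
      interval_cases n <;> norm_num
    have hne : s.Nonempty := card_pos.1 (by omega)
    have hmem := s.max'_mem hne
    have hmax := card_add_two_le_max hs (m := s.max' hne) (fun p hp => s.le_max' p hp) (by omega)
    set m := s.max' hne
    have hih := ih (s.erase m) (fun p hp => hs p (mem_of_mem_erase hp))
      (by rw [card_erase_of_mem hmem]; omega)
    rw [← mul_prod_erase s _ hmem]
    have hm : (n : ℝ) + 3 ≤ m := by rw [hn] at hmax; exact_mod_cast hmax
    have hinv : (m : ℝ)⁻¹ ≤ ((n : ℝ) + 3)⁻¹ := inv_anti₀ (by positivity) hm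
    have e : 4 / (3 * (((n + 1 : ℕ) : ℝ) + 2)) =
        (1 - ((n : ℝ) + 3)⁻¹) * (4 / (3 * ((n : ℝ) + 2))) := by
      push_cast; field_simp; ring
    rw [e]
    refine mul_le_mul (by linarith) hih (by positivity) ?_
    have : ((n : ℝ) + 3)⁻¹ ≤ 1 := inv_le_one_of_one_le₀ (by linarith [n.cast_nonneg (α := ℝ)])
    linarith

/-- Chinese remaindering: a progression of difference `k` starting with `#S` terms, each divisible
by a member of `S`. -/
theorem exists_progression_covered (k : ℕ) (S : Finset ℕ) (hS : ∀ q ∈ S, q.Prime)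
    (hk : ∀ q ∈ S, ¬ q ∣ k) : ∃ a, ∀ i < #S, ∃ q ∈ S, q ∣ a + k * i := by
  induction S using Finset.induction_on with
  | empty => exact ⟨0, by simp⟩
  | insert p S hp ih =>
    obtain ⟨a, ha⟩ := ih (fun q hq => hS q (mem_insert_of_mem hq))
      (fun q hq => hk q (mem_insert_of_mem hq))
    have hpp := hS p (mem_insert_self _ _)
    have hco : Nat.Coprime (∏ q ∈ S, q) p := Nat.Coprime.prod_left fun q hq =>
      (Nat.coprime_primes (hS q (mem_insert_of_mem hq)) hpp).2 (fun h => hp (h ▸ hq))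
    obtain ⟨c, hc1, hc2⟩ := Nat.chineseRemainder hco a ((p - 1) * (k * #S))
    refine ⟨c, fun i hi => ?_⟩
    rw [card_insert_of_notMem hp] at hi
    rcases Nat.lt_succ_iff_lt_or_eq.1 hi with h | rfl
    · obtain ⟨q, hq, hdv⟩ := ha i h
      refine ⟨q, mem_insert_of_mem hq, ?_⟩
      have : c + k * i ≡ a + k * i [MOD q] :=
        (hc1.of_dvd (dvd_prod_of_mem _ hq)).add_right _
      exact (this.dvd_iff dvd_rfl).2 hdv
    · refine ⟨p, mem_insert_self _ _, ?_⟩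
      have h1 : c + k * #S ≡ (p - 1) * (k * #S) + k * #S [MOD p] := hc2.add_right _
      refine (h1.dvd_iff dvd_rfl).2 ⟨k * #S, ?_⟩
      obtain ⟨m, rfl⟩ : ∃ m, p = m + 1 := ⟨p - 1, by have := hpp.pos; omega⟩
      simp only [Nat.add_sub_cancel]
      ring

/-- If the first `n` terms of a reduced residue class mod `k` are not prime, the class forces
the `φ(k) + ω(k)`-th prime to be at least `n * k`. -/
theorem le_nthPrime_div {k r n : ℕ} (hP : IsPInteger k) (hr : r < k) (hc : r.Coprime k)
    (hn : ∀ i < n, ¬ (r + k * i).Prime) :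
    n ≤ nthPrime (k.totient + #k.primeFactors) / k := by
  obtain ⟨hk1, -, himg⟩ := hP
  obtain ⟨i, hi, hir⟩ : r ∈ (fun i => nthPrimeNotDvd k i % k) '' Set.Iio k.totient := by
    rw [himg]; exact ⟨hr, hc⟩
  simp only at hir
  set p := nthPrimeNotDvd k i with hpdef
  have hinf : {p : ℕ | p.Prime ∧ ¬ p ∣ k}.Infinite := by
    have h1 : {p : ℕ | p.Prime}.Infinite := Nat.infinite_setOfPred_prime
    refine (h1.sdiff (Set.finite_Iic k)).mono fun q hq => ⟨hq.1, fun hd => hq.2 ?_⟩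
    exact Nat.le_of_dvd (by omega) hd
  have hpp : p.Prime ∧ ¬ p ∣ k := Nat.nth_mem_of_infinite hinf i
  have hcount : Nat.count (fun q => q.Prime ∧ ¬ q ∣ k) p = i := Nat.count_nth_of_infinite hinf i
  have hcount2 : Nat.count Nat.Prime p ≤ i + #k.primeFactors := by
    rw [← hcount, Nat.count_eq_card_filter_range, Nat.count_eq_card_filter_range]
    refine le_trans (card_le_card ?_) (card_union_le _ _)
    intro q hq
    simp only [mem_filter, mem_range, mem_union, Nat.mem_primeFactors] at hq ⊢
    by_cases hd : q ∣ k
    · exact Or.inr ⟨hq.2, hd, by omega⟩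
    · exact Or.inl ⟨hq.1, hq.2, hd⟩
  have hle : p ≤ nthPrime (k.totient + #k.primeFactors) := by
    have e := Nat.nth_count hpp.1
    rw [← e]
    refine Nat.nth_monotone Nat.infinite_setOfPred_prime ?_
    have : i < k.totient := hi
    omega
  have hpk : n ≤ p / k := by
    by_contra! hlt
    refine hn _ hlt ?_
    rw [← hir, Nat.mod_add_div]
    exact hpp.1
  exact hpk.trans (Nat.div_le_div_right hle)

theorem one_le_nthPrime_div {k : ℕ} (hP : IsPInteger k) :
    1 ≤ nthPrime (k.totient + #k.primeFactors) / k := by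
  refine le_nthPrime_div (r := 1) hP hP.1 (Nat.coprime_one_left k) fun i hi => ?_
  obtain rfl : i = 0 := by omega
  simpa using Nat.not_prime_one

theorem card_le_nthPrime_div {k : ℕ} (hP : IsPInteger k) (S : Finset ℕ)
    (hS : ∀ q ∈ S, q.Prime) (hSk : ∀ q ∈ S, ¬ q ∣ k)
    (hQ : (∏ q ∈ S, q) * (2 ^ #k.primeFactors * (3 * (#k.primeFactors + 2))) ≤ 4 * k) :
    #S ≤ nthPrime (k.totient + #k.primeFactors) / k := by
  by_cases h1 : #S ≤ 1
  · exact h1.trans (one_le_nthPrime_div hP)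
  have hk0 : 0 < k := lt_trans zero_lt_one hP.1
  obtain ⟨a, ha⟩ := exists_progression_covered k S hS hSk
  set Q := ∏ q ∈ S, q with hQdef
  set w := #k.primeFactors with hw
  have hQ0 : 0 < Q := prod_pos fun q hq => (hS q hq).pos
  have hw1 : 1 ≤ w := card_pos.2 (Nat.nonempty_primeFactors.2 hP.1)
  have hQlt : ∀ q ∈ S, q < Q := by
    intro q hq
    obtain ⟨q', hq', hne⟩ := exists_mem_ne (not_le.1 h1) q
    have hdv : q * q' ∣ Q := by
      rw [hQdef, ← mul_prod_erase S _ hq]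
      exact mul_dvd_mul_left _ (dvd_prod_of_mem _ (mem_erase.2 ⟨hne, hq'⟩))
    have := Nat.le_of_dvd hQ0 hdv
    have := (hS q hq).pos
    have := (hS q' hq').two_le
    nlinarith
  set X := k / Q - 1 with hX
  have hcop : ∀ p ∈ k.primeFactors, ¬ p ∣ Q := by
    intro p hp hd
    obtain ⟨q, hq, hpq⟩ := (Prime.dvd_finsetProd_iff (Nat.prime_of_mem_primeFactors hp).prime _).1 hd
    have := (Nat.prime_dvd_prime_iff_eq (Nat.prime_of_mem_primeFactors hp) (hS q hq)).1 hpq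
    exact hSk q hq (this ▸ Nat.dvd_of_mem_primeFactors hp)
  have hsieve := abs_card_sieve_sub_le k.primeFactors
    (fun p hp => Nat.prime_of_mem_primeFactors hp) (a % Q + Q) Q X hcop
  have hprod := le_prod_one_sub_inv w k.primeFactors
    (fun p hp => Nat.prime_of_mem_primeFactors hp) rfl
  have hXbig : 2 ^ w * (3 * (w + 2)) ≤ 4 * (X + 1) + 3 := by
    have hlt : k < Q * (k / Q + 1) := by
      rw [mul_comm]; exact Nat.lt_mul_of_div_lt (Nat.lt_succ_self _) hQ0
    have : Q * (2 ^ w * (3 * (w + 2))) < Q * (4 * (k / Q + 1)) := by linarith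
    have := Nat.lt_of_mul_lt_mul_left this
    omega
  have hpos : 0 < #{j ∈ range X | ∀ p ∈ k.primeFactors, ¬ p ∣ a % Q + Q + Q * j} := by
    have hXR : (2 : ℝ) ^ w * (3 * (w + 2)) ≤ 4 * (X + 1) + 3 := by exact_mod_cast hXbig
    have hwR : (1 : ℝ) ≤ w := by exact_mod_cast hw1
    have hmain : (2 : ℝ) ^ w - 1 < X * ∏ p ∈ k.primeFactors, (1 - (p : ℝ)⁻¹) := by
      refine lt_of_lt_of_le ?_ (mul_le_mul_of_nonneg_left hprod (Nat.cast_nonneg X))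
      rw [mul_div_assoc', lt_div_iff₀ (by positivity)]
      nlinarith
    rw [abs_le] at hsieve
    have : (0 : ℝ) < #{j ∈ range X | ∀ p ∈ k.primeFactors, ¬ p ∣ a % Q + Q + Q * j} := by
      linarith [hsieve.1]
    exact_mod_cast this
  obtain ⟨j, hj⟩ := card_pos.1 hpos
  simp only [mem_filter, mem_range] at hj
  obtain ⟨hjX, hjc⟩ := hj
  set r := a % Q + Q + Q * j with hrdef
  have hrk : r < k := by
    have h2 : Q * (k / Q) ≤ k := Nat.mul_div_le _ _
    have h3 : a % Q < Q := Nat.mod_lt _ hQ0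
    have h4 : Q * (j + 2) ≤ Q * (k / Q) := Nat.mul_le_mul_left _ (by omega)
    have h5 : Q * (j + 2) = Q * j + Q + Q := by ring
    omega
  refine le_nthPrime_div hP hrk ?_ fun i hi hprime => ?_
  · refine Nat.coprime_of_dvd fun p hp hpr hpk => ?_
    exact hjc p (Nat.mem_primeFactors.2 ⟨hp, hpk, by omega⟩) hpr
  · obtain ⟨q, hq, hdv⟩ := ha i hi
    have hqr : q ∣ r + k * i := by
      have e : r + k * i + Q * (a / Q) = (a + k * i) + Q * (1 + j) := by
        have := Nat.mod_add_div a Q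
        rw [hrdef]; linarith
      have hqQ : q ∣ Q := dvd_prod_of_mem _ hq
      have : q ∣ r + k * i + Q * (a / Q) := by
        rw [e]; exact dvd_add hdv (hqQ.mul_right _)
      exact (Nat.dvd_add_left (hqQ.mul_right _)).1 this
    have := (Nat.prime_dvd_prime_iff_eq (hS q hq) hprime).1 hqr
    have := hQlt q hq
    omega

/-- A lower bound for `⌊p_T / k⌋`, given enough primes up to `z`. -/
theorem le_nthPrime_div_of_pow {k : ℕ} (hP : IsPInteger k) {n z : ℕ}
    (hz : #k.primeFactors + n ≤ Nat.primeCounting z)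
    (hk : z ^ n * (2 ^ #k.primeFactors * (3 * (#k.primeFactors + 2))) ≤ 4 * k) :
    n ≤ nthPrime (k.totient + #k.primeFactors) / k := by
  have h1 : n ≤ #(Nat.primesLE z \ k.primeFactors) := by
    have := le_card_sdiff k.primeFactors (Nat.primesLE z)
    rw [Nat.primesLE_card_eq_primeCounting] at this
    omega
  obtain ⟨S, hS, rfl⟩ := exists_subset_card_eq h1
  have hmem : ∀ q ∈ S, (q ≤ z ∧ q.Prime) ∧ q ∉ k.primeFactors := fun q hq => by
    have := mem_sdiff.1 (hS hq)
    exact ⟨Nat.mem_primesLE.1 this.1, this.2⟩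
  refine card_le_nthPrime_div hP S (fun q hq => (hmem q hq).1.2) (fun q hq hd => ?_) ?_
  · exact (hmem q hq).2 (Nat.mem_primeFactors.2 ⟨(hmem q hq).1.2, hd, by have := hP.1; omega⟩)
  · refine le_trans (Nat.mul_le_mul_right _ ?_) hk
    exact prod_le_pow_card S _ _ fun q hq => (hmem q hq).1.1

theorem primorial_le_prod {S : Finset ℕ} (hS : ∀ p ∈ S, p.Prime) {v : ℕ}
    (hv : Nat.primeCounting v ≤ #S) : primorial v ≤ ∏ p ∈ S, p := by
  have hprim : primorial v = ∏ p ∈ Nat.primesLE v, p := rfl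
  rw [hprim, ← prod_inter_mul_prod_sdiff S (Nat.primesLE v),
    ← prod_inter_mul_prod_sdiff (Nat.primesLE v) S, inter_comm]
  refine Nat.mul_le_mul_left _ ?_
  have hcard : #(Nat.primesLE v \ S) ≤ #(S \ Nat.primesLE v) := by
    have h1 := card_sdiff_add_card_inter S (Nat.primesLE v)
    have h2 := card_sdiff_add_card_inter (Nat.primesLE v) S
    rw [inter_comm] at h2
    rw [Nat.primesLE_card_eq_primeCounting] at h2
    omega
  calc ∏ p ∈ Nat.primesLE v \ S, p ≤ v ^ #(Nat.primesLE v \ S) :=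
        prod_le_pow_card _ _ _ fun p hp => (Nat.mem_primesLE.1 (mem_sdiff.1 hp).1).1
    _ ≤ (v + 1) ^ #(Nat.primesLE v \ S) := Nat.pow_le_pow_left (Nat.le_succ v) _
    _ ≤ (v + 1) ^ #(S \ Nat.primesLE v) := Nat.pow_le_pow_right (Nat.succ_pos v) hcard
    _ ≤ ∏ p ∈ S \ Nat.primesLE v, p := by
        refine pow_card_le_prod _ _ _ fun p hp => ?_
        have hp' := mem_sdiff.1 hp
        by_contra! hlt
        exact hp'.2 (Nat.mem_primesLE.2 ⟨by omega, hS p hp'.1⟩)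

theorem card_primeFactors_lt {k v : ℕ} (hk : 0 < k) (h : k < primorial v) :
    #k.primeFactors < Nat.primeCounting v := by
  by_contra! hle
  have h1 := primorial_le_prod (fun p hp => Nat.prime_of_mem_primeFactors hp) hle
  have h2 := Nat.le_of_dvd hk (Nat.prod_primeFactors_dvd k)
  omega

theorem two_mul_card_le_max_add_two {s : Finset ℕ} (hs : ∀ p ∈ s, p.Prime) {m : ℕ}
    (hm : ∀ p ∈ s, p ≤ m) : 2 * #s ≤ m + 2 := by
  have hodd : ∀ p ∈ s.erase 2, p.Prime ∧ p % 2 = 1 ∧ p ≤ m := fun p hp => by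
    have hp' := mem_erase.1 hp
    exact ⟨hs p hp'.2, (hs p hp'.2).mod_two_eq_one_iff_ne_two.2 hp'.1, hm p hp'.2⟩
  have h1 : #(s.erase 2) ≤ #(Icc 1 (m / 2)) := by
    refine card_le_card_of_injOn (· / 2) (fun p hp => ?_) (fun p hp q hq hpq => ?_)
    · obtain ⟨hpr, -, hle⟩ := hodd p hp
      have := hpr.two_le
      refine mem_coe.2 (mem_Icc.2 ⟨?_, ?_⟩)
      · change 1 ≤ p / 2
        omega
      · exact Nat.div_le_div_right hle
    · have := (hodd p hp).2.1
      have := (hodd q hq).2.1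
      simp only at hpq
      omega
  have h2 := pred_card_le_card_erase (s := s) (a := 2)
  rw [Nat.card_Icc] at h1
  omega

theorem two_pow_mul_factorial_le_prod (n : ℕ) : ∀ s : Finset ℕ, (∀ p ∈ s, p.Prime) →
    #s = n + 1 → 2 ^ (n + 1) * (n + 1).factorial ≤ 2 * (n + 1) * ∏ p ∈ s, p := by
  induction n with
  | zero =>
    intro s hs hn
    obtain ⟨p, rfl⟩ := card_eq_one.1 hn
    have := (hs p (mem_singleton_self p)).two_le
    simp
    omega
  | succ n ih =>
    intro s hs hn
    have hne : s.Nonempty := card_pos.1 (by omega)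
    have hmem := s.max'_mem hne
    have hmax := two_mul_card_le_max_add_two hs (m := s.max' hne) (fun p hp => s.le_max' p hp)
    set m := s.max' hne
    have hih := ih (s.erase m) (fun p hp => hs p (mem_of_mem_erase hp))
      (by rw [card_erase_of_mem hmem]; omega)
    rw [← mul_prod_erase s _ hmem, Nat.factorial_succ (n + 1), pow_succ]
    have hm : 2 * (n + 1) ≤ m := by omega
    calc 2 ^ (n + 1) * 2 * ((n + 1 + 1) * (n + 1).factorial)
        = 2 * (n + 1 + 1) * (2 ^ (n + 1) * (n + 1).factorial) := by ring
      _ ≤ 2 * (n + 1 + 1) * (2 * (n + 1) * ∏ p ∈ s.erase m, p) := Nat.mul_le_mul_left _ hih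
      _ ≤ 2 * (n + 1 + 1) * (m * ∏ p ∈ s.erase m, p) := by gcongr

theorem card_primeFactors_mul_log_le {k : ℕ} (hk : 1 < k) :
    (#k.primeFactors : ℝ) * Real.log (2 * #k.primeFactors) - #k.primeFactors ≤
      Real.log k + Real.log (2 * #k.primeFactors) := by
  have hw1 : 1 ≤ #k.primeFactors := card_pos.2 (Nat.nonempty_primeFactors.2 hk)
  obtain ⟨n, hn⟩ : ∃ n, #k.primeFactors = n + 1 := ⟨_, (Nat.sub_add_cancel hw1).symm⟩
  have h1 := two_pow_mul_factorial_le_prod n k.primeFactors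
    (fun p hp => Nat.prime_of_mem_primeFactors hp) hn
  have h2 := Nat.le_of_dvd (by omega) (Nat.prod_primeFactors_dvd k)
  rw [← hn] at h1
  set w := #k.primeFactors
  have h3 : 2 ^ w * w.factorial ≤ 2 * w * k := h1.trans (Nat.mul_le_mul_left _ h2)
  have h3R : (2 : ℝ) ^ w * w.factorial ≤ 2 * w * k := by exact_mod_cast h3
  have hwR : (0 : ℝ) < w := by exact_mod_cast hw1
  have hkR : (0 : ℝ) < k := by exact_mod_cast (by omega : 0 < k)
  have h4 := Real.pow_div_factorial_le_exp (w : ℝ) hwR.le w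
  rw [div_le_iff₀ (by positivity)] at h4
  have h5 : (2 * (w : ℝ)) ^ w ≤ Real.exp w * (2 * w * k) := by
    rw [mul_pow]
    calc (2 : ℝ) ^ w * (w : ℝ) ^ w ≤ 2 ^ w * (Real.exp w * w.factorial) := by gcongr
      _ = Real.exp w * (2 ^ w * w.factorial) := by ring
      _ ≤ _ := by gcongr
  have h6 := Real.log_le_log (by positivity) h5
  rw [Real.log_pow, Real.log_mul (Real.exp_pos _).ne' (by positivity), Real.log_exp,
    Real.log_mul (mul_pos two_pos hwR).ne' hkR.ne'] at h6
  linarith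

theorem exp_div_le_of_pow_le {c : ℝ} (hc : 0 ≤ c) (j m : ℕ) (hm : 0 < m)
    (h : (2.7182818286 : ℝ) ^ j ≤ c ^ m) : Real.exp (j / m) ≤ c := by
  refine le_of_pow_le_pow_left₀ hm.ne' hc ?_
  rw [← Real.exp_nat_mul, mul_div_cancel₀ _ (by positivity), Real.exp_one_pow j |>.symm]
  exact (pow_le_pow_left₀ (Real.exp_pos 1).le Real.exp_one_lt_d9.le j).trans h

theorem const_le_h {y : ℝ} (hy : 0 < y) : 4.228 ≤ 1.7811 * y + 2.51 / y := by
  have e : 1.7811 * y + 2.51 / y = (1.7811 * y ^ 2 + 2.51) / y := by field_simp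
  rw [e, le_div_iff₀ hy]
  nlinarith [sq_nonneg (y - 1.187)]

theorem h_mono {x y : ℝ} (hx : 1.2 ≤ x) (hxy : x ≤ y) :
    1.7811 * x + 2.51 / x ≤ 1.7811 * y + 2.51 / y := by
  have hx0 : 0 < x := by linarith
  have hy0 : 0 < y := by linarith
  have hxy2 : 1.44 ≤ x * y := by nlinarith
  have e : 2.51 / x - 2.51 / y = 2.51 / (x * y) * (y - x) := by field_simp
  have h1 : 2.51 / (x * y) ≤ 1.7811 := by
    rw [div_le_iff₀ (by positivity)]; linarith
  nlinarith

/-- The target inequality, from an integer lower bound `n` for `t` and a lower bound `H`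
for `h`. -/
theorem sub_log_div_lt {L h H : ℝ} {n t : ℕ} (hH : H ≤ h) (hH4 : 4.228 ≤ H) (hn : n ≤ t)
    (hL : L < (n + 1) * H + 1.4) : (L - Real.log h) / h < (t : ℝ) + 1 := by
  have hh : 0 < h := by linarith
  have h1 : (1.4 : ℝ) ≤ Real.log h := by
    rw [Real.le_log_iff_exp_le hh]
    have := exp_div_le_of_pow_le (c := 4.228) (by norm_num) 7 5 (by norm_num) (by norm_num)
    have e : ((7 : ℕ) : ℝ) / ((5 : ℕ) : ℝ) = 1.4 := by norm_num
    rw [e] at this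
    linarith
  have hnR : (n : ℝ) ≤ t := by exact_mod_cast hn
  rw [div_lt_iff₀ hh]
  nlinarith [n.cast_nonneg (α := ℝ)]

theorem log_lower {A a : ℕ} (hA : 2 ^ a ≤ A ^ 20) : (a : ℝ) / 20 * 0.6931471803 ≤ Real.log A := by
  have h1 : ((2 : ℝ) ^ a) ≤ (A : ℝ) ^ 20 := by exact_mod_cast hA
  have h2 := Real.log_le_log (by positivity) h1
  rw [Real.log_pow, Real.log_pow] at h2
  have := mul_le_mul_of_nonneg_left Real.log_two_gt_d9.le (Nat.cast_nonneg (α := ℝ) a)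
  push_cast at h2
  linarith

theorem log_upper {B b : ℕ} (hB0 : 0 < B) (hB : B ^ 20 ≤ 2 ^ b) :
    Real.log B ≤ (b : ℝ) / 20 * 0.6931471808 := by
  have h1 : (B : ℝ) ^ 20 ≤ (2 : ℝ) ^ b := by exact_mod_cast hB
  have hB0' : (0 : ℝ) < B := by exact_mod_cast hB0
  have h2 := Real.log_le_log (by positivity) h1
  rw [Real.log_pow, Real.log_pow] at h2
  have := mul_le_mul_of_nonneg_left Real.log_two_lt_d9.le (Nat.cast_nonneg (α := ℝ) b)
  push_cast at h2
  linarith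

/-- The bound on a bounded range `A ≤ k < B`, reduced to numerical conditions. -/
theorem bound_of_mem_Ico {k : ℕ} (hP : IsPInteger k) (A B a b v z n W j : ℕ)
    (hA : 2 ^ a ≤ A ^ 20) (hB : B ^ 20 ≤ 2 ^ b) (hv : B ≤ primorial v)
    (hW : Nat.primeCounting v = W + 1) (hz : W + n ≤ Nat.primeCounting z)
    (hpow : z ^ n * (2 ^ W * (3 * (W + 2))) ≤ 4 * A) (hj24 : 24 ≤ j)
    (hj : (2.7182818286 : ℝ) ^ j ≤ ((a : ℝ) / 20 * 0.6931471803) ^ 20)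
    (hD : (b : ℝ) / 20 * 0.6931471808 <
      (n + 1) * (1.7811 * ((j : ℝ) / 20) + 2.51 / ((j : ℝ) / 20)) + 1.4)
    (hAk : A ≤ k) (hkB : k < B) :
    (Real.log k - Real.log (1.7811 * Real.log (Real.log k) + 2.51 / Real.log (Real.log k))) /
      (1.7811 * Real.log (Real.log k) + 2.51 / Real.log (Real.log k)) <
      ((nthPrime (k.totient + #k.primeFactors) / k : ℕ) : ℝ) + 1 := by
  have hk0 : 0 < k := lt_trans zero_lt_one hP.1
  have hA0 : 0 < A := by
    rcases Nat.eq_zero_or_pos A with rfl | h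
    · simp at hA
    · exact h
  have hw : #k.primeFactors ≤ W := by
    have := card_primeFactors_lt hk0 (hkB.trans_le hv)
    omega
  have ht : n ≤ nthPrime (k.totient + #k.primeFactors) / k := by
    refine le_nthPrime_div_of_pow hP (z := z) (by omega) (le_trans ?_ (hpow.trans (by omega)))
    gcongr
    norm_num
  have hlogA : (a : ℝ) / 20 * 0.6931471803 ≤ Real.log k :=
    (log_lower hA).trans (Real.log_le_log (by exact_mod_cast hA0) (by exact_mod_cast hAk))
  have hlogB : Real.log k ≤ (b : ℝ) / 20 * 0.6931471808 :=
    (Real.log_le_log (by exact_mod_cast hk0) (by exact_mod_cast hkB.le)).trans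
      (log_upper (by omega) hB)
  have hexp := (exp_div_le_of_pow_le (by positivity) j 20 (by norm_num) hj).trans hlogA
  have hy : (j : ℝ) / 20 ≤ Real.log (Real.log k) := by
    rw [Real.le_log_iff_exp_le (lt_of_lt_of_le (Real.exp_pos _) hexp)]
    exact_mod_cast hexp
  have hjR : (24 : ℝ) ≤ j := by exact_mod_cast hj24
  exact sub_log_div_lt (h_mono (by linarith) hy) (const_le_h (by linarith)) ht
    (hlogB.trans_lt hD)

theorem bound_of_lt_two_pow {k : ℕ} (hP : IsPInteger k) (hk : 30 < k) (hk2 : k < 2 ^ 14) :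
    (Real.log k - Real.log (1.7811 * Real.log (Real.log k) + 2.51 / Real.log (Real.log k))) /
      (1.7811 * Real.log (Real.log k) + 2.51 / Real.log (Real.log k)) <
      ((nthPrime (k.totient + #k.primeFactors) / k : ℕ) : ℝ) + 1 := by
  have h1 : Real.log k ≤ ((280 : ℕ) : ℝ) / 20 * 0.6931471808 :=
    (Real.log_le_log (by exact_mod_cast (by omega : 0 < k)) (by exact_mod_cast hk2.le)).trans
      (log_upper (B := 2 ^ 14) (by norm_num) (by rw [← pow_mul]))
  have h2 : 1 < Real.log k := by
    rw [Real.lt_log_iff_exp_lt (by exact_mod_cast (by omega : 0 < k))]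
    have : (30 : ℝ) < k := by exact_mod_cast hk
    linarith [Real.exp_one_lt_d9]
  refine sub_log_div_lt (const_le_h (Real.log_pos h2)) le_rfl (one_le_nthPrime_div hP)
    (h1.trans_lt ?_)
  norm_num

theorem omega_bound_of_mul_log_le {L y w : ℝ} (hy : 5.6 ≤ y) (hL : 48 * y ≤ L)
    (hyL : y = Real.log L)
    (hw : w * Real.log (2 * w) - w ≤ L + Real.log (2 * w)) : w ≤ 1.5 * (L / y) := by
  by_contra! hlt
  have hy0 : 0 < y := by linarith
  have hL0 : 0 < L := by linarith
  set u := L / y with hu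
  have hLu : L = u * y := by rw [hu]; field_simp
  have hu48 : 48 ≤ u := by rw [hu, le_div_iff₀ hy0]; exact hL
  have hlog56 : Real.log (28 / 5) ≤ 1.7273 := by
    have h1 : Real.log (28 / 5) ≤ Real.log (3 ^ 2 * 5 / 2 ^ 3) :=
      Real.log_le_log (by norm_num) (by norm_num)
    rw [Real.log_div (x := 3 ^ 2 * 5) (by norm_num) (by norm_num),
      Real.log_mul (by norm_num) (by norm_num), Real.log_pow, Real.log_pow] at h1
    push_cast at h1
    linarith [Real.log_two_gt_d9, Real.log_three_lt_d9, Real.log_five_lt_d9]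
  have hlogy : Real.log y ≤ 0.7273 + y * (5 / 28) := by
    have h1 : Real.log y = Real.log (28 / 5) + Real.log (y * (5 / 28)) := by
      rw [← Real.log_mul (by norm_num) (by positivity)]
      congr 1
      ring
    have h2 := Real.log_le_sub_one_of_pos (show 0 < y * (5 / 28) by positivity)
    linarith
  have hl : 0.8214 * y + 0.37 ≤ Real.log (2 * w) := by
    have h1 : Real.log (3 * u) ≤ Real.log (2 * w) :=
      Real.log_le_log (by positivity) (by linarith)
    rw [Real.log_mul (by norm_num) (by positivity), hu, Real.log_div hL0.ne' hy0.ne',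
      ← hyL] at h1
    linarith [Real.log_three_gt_d9]
  have h1 : (w - 1) * (0.8214 * y + 0.37) ≤ (w - 1) * Real.log (2 * w) :=
    mul_le_mul_of_nonneg_left hl (by linarith)
  have h2 : 1.5 * u * (0.8214 * y - 0.63) ≤ w * (0.8214 * y - 0.63) :=
    mul_le_mul_of_nonneg_right hlt.le (by linarith)
  have h3 : 48 * (0.2321 * y - 0.945) ≤ u * (0.2321 * y - 0.945) :=
    mul_le_mul_of_nonneg_right hu48 (by linarith)
  nlinarith

theorem bound_of_large {k : ℕ} (hP : IsPInteger k) (hk : 2 ^ 392 ≤ k) :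
    (Real.log k - Real.log (1.7811 * Real.log (Real.log k) + 2.51 / Real.log (Real.log k))) /
      (1.7811 * Real.log (Real.log k) + 2.51 / Real.log (Real.log k)) <
      ((nthPrime (k.totient + #k.primeFactors) / k : ℕ) : ℝ) + 1 := by
  have hk0 : 0 < k := lt_trans zero_lt_one hP.1
  have hkR : (0 : ℝ) < k := by exact_mod_cast hk0
  have hw1 : 1 ≤ #k.primeFactors := card_pos.2 (Nat.nonempty_primeFactors.2 hP.1)
  have hwlog := card_primeFactors_mul_log_le hP.1
  set w := #k.primeFactors
  set L := Real.log k with hLdef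
  set y := Real.log L with hydef
  have hL : 271.7 ≤ L := by
    have h1 : Real.log ((2 : ℝ) ^ 392) ≤ L :=
      Real.log_le_log (by positivity) (by exact_mod_cast hk)
    rw [Real.log_pow] at h1
    push_cast at h1
    linarith [Real.log_two_gt_d9]
  clear hk
  have hL0 : 0 < L := by linarith
  have hy : 5.6 ≤ y := by
    rw [hydef, Real.le_log_iff_exp_le hL0]
    have := exp_div_le_of_pow_le (c := 271.7) (by norm_num) 28 5 (by norm_num) (by norm_num)
    have e : ((28 : ℕ) : ℝ) / ((5 : ℕ) : ℝ) = 5.6 := by norm_num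
    rw [e] at this
    linarith
  have hy0 : 0 < y := by linarith
  have hL48 : 48 * y ≤ L := by
    have h1 := Real.log_le_sub_one_of_pos (show 0 < L * (8 / 3 ^ 7) by positivity)
    rw [Real.log_mul hL0.ne' (by norm_num), ← hydef, show (8 : ℝ) = 2 ^ 3 by norm_num,
      Real.log_div (by norm_num) (by norm_num), Real.log_pow, Real.log_pow] at h1
    push_cast at h1
    linarith [Real.log_two_gt_d9, Real.log_three_lt_d9]
  have hwR : (1 : ℝ) ≤ w := by exact_mod_cast hw1
  have hw := omega_bound_of_mul_log_le hy hL48 hydef hwlog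
  set u := L / y with hu
  have hLu : L = u * y := by rw [hu]; field_simp
  have hu48 : 48 ≤ u := by rw [hu, le_div_iff₀ hy0]; exact hL48
  set n := ⌊u / 1.7811⌋₊ with hndef
  have hn : (n : ℝ) ≤ u / 1.7811 := Nat.floor_le (by positivity)
  have hn' : (n : ℝ) ≤ 0.56146 * u := by
    rw [le_div_iff₀ (by norm_num)] at hn; linarith
  have hn1 : u / 1.7811 < n + 1 := Nat.lt_floor_add_one _
  set z := ⌊4 * L⌋₊ with hzdef
  have hz : (z : ℝ) ≤ 4 * L := Nat.floor_le (by positivity)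
  have hz1 : 4 * L < z + 1 := Nat.lt_floor_add_one _
  have hz0 : (1 : ℝ) < z := by linarith
  have hlog2 := Real.log_two_gt_d9
  have hlog2' := Real.log_two_lt_d9
  have hlogz : Real.log z ≤ y + 1.3863 := by
    have h1 := Real.log_le_log (by linarith) hz
    rw [Real.log_mul (by norm_num) hL0.ne', show (4 : ℝ) = 2 ^ 2 by norm_num, Real.log_pow] at h1
    push_cast at h1
    linarith
  have hlogz1 : Real.log (z + 1) ≤ y + 2.08 := by
    have h1 := Real.log_le_log (by linarith) (show (z : ℝ) + 1 ≤ 8 * L by linarith)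
    rw [Real.log_mul (by norm_num) hL0.ne', show (8 : ℝ) = 2 ^ 3 by norm_num, Real.log_pow] at h1
    push_cast at h1
    linarith
  have hlogz0 : 0 < Real.log z := Real.log_pos hz0
  have huy : 48 * y ≤ u * y := mul_le_mul_of_nonneg_right hu48 hy0.le
  have huy' : 5.6 * u ≤ u * y := by nlinarith
  clear_value n z
  have hcount : w + n ≤ Nat.primeCounting z := by
    have h1 := Chebyshev.pi_ge z
    have h2 : ((w + n : ℕ) : ℝ) ≤ (z * Real.log 2 - Real.log (z + 1)) / Real.log z := by
      rw [le_div_iff₀ hlogz0]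
      push_cast
      have h3 : ((w : ℝ) + n) * Real.log z ≤ 2.06146 * u * (y + 1.3863) :=
        mul_le_mul (by linarith) hlogz hlogz0.le (by positivity)
      have h4 : (4 * (u * y) - 1) * 0.6931471803 ≤ z * Real.log 2 :=
        mul_le_mul (by linarith) hlog2.le (by norm_num) (by linarith)
      linarith
    exact_mod_cast h2.trans h1
  have hpow : z ^ n * (2 ^ w * (3 * (w + 2))) ≤ 4 * k := by
    have hzn : (0 : ℝ) < (z : ℝ) ^ n := pow_pos (by linarith) n
    have h2w : (0 : ℝ) < 2 ^ w := pow_pos two_pos w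
    have h3w : (0 : ℝ) < 3 * ((w : ℝ) + 2) := by linarith
    have h1 : Real.log ((z : ℝ) ^ n * (2 ^ w * (3 * (w + 2)))) ≤ Real.log (4 * k) := by
      have h2 : Real.log (3 * ((w : ℝ) + 2)) ≤ Real.log 4 + y := by
        rw [hydef, ← Real.log_mul (by norm_num) hL0.ne']
        exact Real.log_le_log h3w (by linarith)
      rw [Real.log_mul hzn.ne' (mul_pos h2w h3w).ne', Real.log_mul h2w.ne' h3w.ne',
        Real.log_mul (by norm_num) hkR.ne', Real.log_pow, Real.log_pow, ← hLdef]
      have h3 : (n : ℝ) * Real.log z ≤ 0.56146 * u * (y + 1.3863) :=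
        mul_le_mul hn' hlogz hlogz0.le (by positivity)
      have h4 : (w : ℝ) * Real.log 2 ≤ 1.5 * u * 0.6931471808 :=
        mul_le_mul hw hlog2'.le (by linarith) (by positivity)
      linarith
    have h5 := (Real.log_le_log_iff (mul_pos hzn (mul_pos h2w h3w)) (by linarith)).1 h1
    exact_mod_cast h5
  have ht := le_nthPrime_div_of_pow hP hcount hpow
  have htR : (n : ℝ) ≤ ((nthPrime (k.totient + w) / k : ℕ) : ℝ) := by exact_mod_cast ht
  have hh : 1.7811 * y ≤ 1.7811 * y + 2.51 / y := le_add_of_nonneg_right (by positivity)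
  have hh4 := const_le_h hy0
  set h := 1.7811 * y + 2.51 / y
  have hlogh : 0 ≤ Real.log h := Real.log_nonneg (by linarith)
  calc (L - Real.log h) / h ≤ L / h := by gcongr; linarith
    _ ≤ L / (1.7811 * y) := by gcongr
    _ = u / 1.7811 := by rw [hu, mul_comm, div_div]
    _ < n + 1 := hn1
    _ ≤ _ := by linarith



set_option maxHeartbeats 4000000 in
-- the kernel checks for the rows of the table add up
theorem bound_of_medium {k : ℕ} (hP : IsPInteger k) (h₀ : 2 ^ 14 ≤ k) (hk : k < 2 ^ 392) :
    (Real.log k - Real.log (1.7811 * Real.log (Real.log k) + 2.51 / Real.log (Real.log k))) /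
      (1.7811 * Real.log (Real.log k) + 2.51 / Real.log (Real.log k)) <
      ((nthPrime (k.totient + #k.primeFactors) / k : ℕ) : ℝ) + 1 := by
  rcases lt_or_ge k (90000) with h₁ | h₁
  · exact bound_of_mem_Ico hP (2 ^ 14) (90000) 280 330 17 17 1 6 45 (by decide +kernel)
      (by decide +kernel) (by decide +kernel) (by decide +kernel) (by decide +kernel)
      (by decide +kernel) (by norm_num) (by norm_num) (by norm_num) h₀ h₁
  clear h₀
  rename' h₁ => h₀
  rcases lt_or_ge k (2 ^ 17) with h₁ | h₁
  · exact bound_of_mem_Ico hP (90000) (2 ^ 17) 329 340 17 17 1 6 48 (by decide +kernel)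
      (by decide +kernel) (by decide +kernel) (by decide +kernel) (by decide +kernel)
      (by decide +kernel) (by norm_num) (by norm_num) (by norm_num) h₀ h₁
  clear h₀
  rename' h₁ => h₀
  rcases lt_or_ge k (180000) with h₁ | h₁
  · exact bound_of_mem_Ico hP (2 ^ 17) (180000) 340 350 17 17 1 6 49 (by decide +kernel)
      (by decide +kernel) (by decide +kernel) (by decide +kernel) (by decide +kernel)
      (by decide +kernel) (by norm_num) (by norm_num) (by norm_num) h₀ h₁
  clear h₀
  rename' h₁ => h₀
  rcases lt_or_ge k (510510) with h₁ | h₁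
  · exact bound_of_mem_Ico hP (180000) (510510) 349 380 17 19 2 6 49 (by decide +kernel)
      (by decide +kernel) (by decide +kernel) (by decide +kernel) (by decide +kernel)
      (by decide +kernel) (by norm_num) (by norm_num) (by norm_num) h₀ h₁
  clear h₀
  rename' h₁ => h₀
  rcases lt_or_ge k (9699690) with h₁ | h₁
  · exact bound_of_mem_Ico hP (510510) (9699690) 379 465 19 23 2 7 51 (by decide +kernel)
      (by decide +kernel) (by decide +kernel) (by decide +kernel) (by decide +kernel)
      (by decide +kernel) (by norm_num) (by norm_num) (by norm_num) h₀ h₁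
  clear h₀
  rename' h₁ => h₀
  rcases lt_or_ge k (2 ^ 27) with h₁ | h₁
  · exact bound_of_mem_Ico hP (9699690) (2 ^ 27) 464 540 23 29 2 8 55 (by decide +kernel)
      (by decide +kernel) (by decide +kernel) (by decide +kernel) (by decide +kernel)
      (by decide +kernel) (by norm_num) (by norm_num) (by norm_num) h₀ h₁
  clear h₀
  rename' h₁ => h₀
  rcases lt_or_ge k (2 ^ 28) with h₁ | h₁
  · exact bound_of_mem_Ico hP (2 ^ 27) (2 ^ 28) 540 560 29 31 2 9 58 (by decide +kernel)
      (by decide +kernel) (by decide +kernel) (by decide +kernel) (by decide +kernel)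
      (by decide +kernel) (by norm_num) (by norm_num) (by norm_num) h₀ h₁
  clear h₀
  rename' h₁ => h₀
  rcases lt_or_ge k (6469693230) with h₁ | h₁
  · exact bound_of_mem_Ico hP (2 ^ 28) (6469693230) 560 652 29 37 3 9 59 (by decide +kernel)
      (by decide +kernel) (by decide +kernel) (by decide +kernel) (by decide +kernel)
      (by decide +kernel) (by norm_num) (by norm_num) (by norm_num) h₀ h₁
  clear h₀
  rename' h₁ => h₀
  rcases lt_or_ge k (2 ^ 38) with h₁ | h₁
  · exact bound_of_mem_Ico hP (6469693230) (2 ^ 38) 651 760 37 43 3 11 62 (by decide +kernel)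
      (by decide +kernel) (by decide +kernel) (by decide +kernel) (by decide +kernel)
      (by decide +kernel) (by norm_num) (by norm_num) (by norm_num) h₀ h₁
  clear h₀
  rename' h₁ => h₀
  rcases lt_or_ge k (7420738134810) with h₁ | h₁
  · exact bound_of_mem_Ico hP (2 ^ 38) (7420738134810) 760 856 37 47 4 11 65 (by decide +kernel)
      (by decide +kernel) (by decide +kernel) (by decide +kernel) (by decide +kernel)
      (by decide +kernel) (by norm_num) (by norm_num) (by norm_num) h₀ h₁
  clear h₀
  rename' h₁ => h₀
  rcases lt_or_ge k (2 ^ 50) with h₁ | h₁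
  · exact bound_of_mem_Ico hP (7420738134810) (2 ^ 50) 855 1000 43 59 4 13 67 (by decide +kernel)
      (by decide +kernel) (by decide +kernel) (by decide +kernel) (by decide +kernel)
      (by decide +kernel) (by norm_num) (by norm_num) (by norm_num) h₀ h₁
  clear h₀
  rename' h₁ => h₀
  rcases lt_or_ge k (2 ^ 62) with h₁ | h₁
  · exact bound_of_mem_Ico hP (2 ^ 50) (2 ^ 62) 1000 1240 53 71 5 15 70 (by decide +kernel)
      (by decide +kernel) (by decide +kernel) (by decide +kernel) (by decide +kernel)
      (by decide +kernel) (by norm_num) (by norm_num) (by norm_num) h₀ h₁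
  clear h₀
  rename' h₁ => h₀
  rcases lt_or_ge k (2 ^ 76) with h₁ | h₁
  · exact bound_of_mem_Ico hP (2 ^ 62) (2 ^ 76) 1240 1520 61 83 6 17 75 (by decide +kernel)
      (by decide +kernel) (by decide +kernel) (by decide +kernel) (by decide +kernel)
      (by decide +kernel) (by norm_num) (by norm_num) (by norm_num) h₀ h₁
  clear h₀
  rename' h₁ => h₀
  rcases lt_or_ge k (2 ^ 90) with h₁ | h₁
  · exact bound_of_mem_Ico hP (2 ^ 76) (2 ^ 90) 1520 1800 73 103 7 20 79 (by decide +kernel)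
      (by decide +kernel) (by decide +kernel) (by decide +kernel) (by decide +kernel)
      (by decide +kernel) (by norm_num) (by norm_num) (by norm_num) h₀ h₁
  clear h₀
  rename' h₁ => h₀
  rcases lt_or_ge k (2 ^ 107) with h₁ | h₁
  · exact bound_of_mem_Ico hP (2 ^ 90) (2 ^ 107) 1800 2140 83 127 9 22 82 (by decide +kernel)
      (by decide +kernel) (by decide +kernel) (by decide +kernel) (by decide +kernel)
      (by decide +kernel) (by norm_num) (by norm_num) (by norm_num) h₀ h₁
  clear h₀
  rename' h₁ => h₀
  rcases lt_or_ge k (2 ^ 132) with h₁ | h₁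
  · exact bound_of_mem_Ico hP (2 ^ 107) (2 ^ 132) 2140 2640 103 151 10 26 86 (by decide +kernel)
      (by decide +kernel) (by decide +kernel) (by decide +kernel) (by decide +kernel)
      (by decide +kernel) (by norm_num) (by norm_num) (by norm_num) h₀ h₁
  clear h₀
  rename' h₁ => h₀
  rcases lt_or_ge k (2 ^ 162) with h₁ | h₁
  · exact bound_of_mem_Ico hP (2 ^ 132) (2 ^ 162) 2640 3240 131 191 12 31 90 (by decide +kernel)
      (by decide +kernel) (by decide +kernel) (by decide +kernel) (by decide +kernel)
      (by decide +kernel) (by norm_num) (by norm_num) (by norm_num) h₀ h₁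
  clear h₀
  rename' h₁ => h₀
  rcases lt_or_ge k (2 ^ 207) with h₁ | h₁
  · exact bound_of_mem_Ico hP (2 ^ 162) (2 ^ 207) 3240 4140 163 239 15 37 94 (by decide +kernel)
      (by decide +kernel) (by decide +kernel) (by decide +kernel) (by decide +kernel)
      (by decide +kernel) (by norm_num) (by norm_num) (by norm_num) h₀ h₁
  clear h₀
  rename' h₁ => h₀
  rcases lt_or_ge k (2 ^ 264) with h₁ | h₁
  · exact bound_of_mem_Ico hP (2 ^ 207) (2 ^ 264) 4140 5280 197 307 19 44 99 (by decide +kernel)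
      (by decide +kernel) (by decide +kernel) (by decide +kernel) (by decide +kernel)
      (by decide +kernel) (by norm_num) (by norm_num) (by norm_num) h₀ h₁
  clear h₀
  rename' h₁ => h₀
  rcases lt_or_ge k (2 ^ 339) with h₁ | h₁
  · exact bound_of_mem_Ico hP (2 ^ 264) (2 ^ 339) 5280 6780 257 389 23 54 104 (by decide +kernel)
      (by decide +kernel) (by decide +kernel) (by decide +kernel) (by decide +kernel)
      (by decide +kernel) (by norm_num) (by norm_num) (by norm_num) h₀ h₁
  clear h₀
  rename' h₁ => h₀
  rcases lt_or_ge k (2 ^ 392) with h₁ | h₁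
  · exact bound_of_mem_Ico hP (2 ^ 339) (2 ^ 392) 6780 7840 293 467 30 61 109 (by decide +kernel)
      (by decide +kernel) (by decide +kernel) (by decide +kernel) (by decide +kernel)
      (by decide +kernel) (by norm_num) (by norm_num) (by norm_num) h₀ h₁
  clear h₀
  rename' h₁ => h₀
  exact absurd hk (not_lt.2 h₀)


theorem t_add_one_gt (k : ℕ) (hk : 30 < k) (hP : IsPInteger k) (T t : ℕ)
    (hT : T = k.totient + k.primeFactors.card) (ht : t = nthPrime T / k) (h : ℝ)
    (hh : h = 1.7811 * Real.log (Real.log k) + 2.51 / Real.log (Real.log k)) :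
    (Real.log k - Real.log h) / h < (t : ℝ) + 1 := by
  subst hT ht hh
  rcases lt_or_ge k (2 ^ 14) with h₀ | h₀
  · exact bound_of_lt_two_pow hP hk h₀
  rcases lt_or_ge k (2 ^ 392) with h₁ | h₁
  · exact bound_of_medium hP h₀ h₁
  · exact bound_of_large hP h₁
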